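/- (Sufficiency part of Proposition 2.5.) Let d ≥ 1 and let I ⊂ ℤ^d∖{0} be a finite set which is a generator and satisfies the connectedness condition. Then H_∞(I) is dense in every C^r topology: for every r ∈ ℕ, every smooth (2πℤ^d)-periodic function f : ℝ^d → ℝ, and every ε > 0, there exists g ∈ H_∞(I) such that for every j ≤ r, sup_{x ∈ ℝ^d} ‖D^j(f − g)(x)‖ < ε, where D^j denotes the j-th iterated (Fréchet) derivative. -/

import Mathlib

open Real MeasureTheory

/-- ⟨x, m⟩ = ∑ x_j m_j for x ∈ ℝ^d, m ∈ ℤ^d. -/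
noncomputable def ip (d : ℕ) (x : Fin d → ℝ) (m : Fin d → ℤ) : ℝ :=
  ∑ j, x j * (m j : ℝ)

/-- Integer inner product on ℤ^d. -/
def ipZ (d : ℕ) (m l : Fin d → ℤ) : ℤ := ∑ j, m j * l j

/-- c_m(x) = cos⟨x,m⟩. -/
noncomputable def cmap (d : ℕ) (m : Fin d → ℤ) : (Fin d → ℝ) → ℝ :=
  fun x => Real.cos (ip d x m)

/-- s_m(x) = sin⟨x,m⟩. -/
noncomputable def smap (d : ℕ) (m : Fin d → ℤ) : (Fin d → ℝ) → ℝ :=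
  fun x => Real.sin (ip d x m)

/-- B(φ)(x) = ∑_j (∂_{x_j} φ(x))². -/
noncomputable def Bop (d : ℕ) (φ : (Fin d → ℝ) → ℝ) : (Fin d → ℝ) → ℝ :=
  fun x => ∑ j, (fderiv ℝ φ x (Pi.single j 1)) ^ 2

/-- Functions representable as θ₀ − ∑_{j=1}^n B(θ_j) with θ's in H, n ≥ 1. -/
noncomputable def BRep (d : ℕ) (H : Set ((Fin d → ℝ) → ℝ)) : Set ((Fin d → ℝ) → ℝ) :=
  { f | ∃ n : ℕ, 1 ≤ n ∧ ∃ θ₀ ∈ H, ∃ θ : Fin n → (Fin d → ℝ) → ℝ,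
      (∀ j, θ j ∈ H) ∧ f = θ₀ - ∑ j, Bop d (θ j) }

/-- F(H): f such that both f and −f are representable. -/
noncomputable def Fop (d : ℕ) (H : Set ((Fin d → ℝ) → ℝ)) : Set ((Fin d → ℝ) → ℝ) :=
  { f | f ∈ BRep d H ∧ -f ∈ BRep d H }

/-- H(I): span of {1} ∪ {c_k, s_k : k ∈ I}. -/
noncomputable def H0 (d : ℕ) (I : Finset (Fin d → ℤ)) : Set ((Fin d → ℝ) → ℝ) :=
  ↑(Submodule.span ℝ
      ({fun _ => (1:ℝ)} ∪ ⋃ k ∈ (I : Set (Fin d → ℤ)), {cmap d k, smap d k}))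

noncomputable def HSeq (d : ℕ) (I : Finset (Fin d → ℤ)) : ℕ → Set ((Fin d → ℝ) → ℝ)
  | 0 => H0 d I
  | j + 1 => Fop d (HSeq d I j)

/-- H_∞(I) = ⋃_j H_j(I). -/
noncomputable def Hinf (d : ℕ) (I : Finset (Fin d → ℤ)) : Set ((Fin d → ℝ) → ℝ) :=
  ⋃ j, HSeq d I j

/-- I generates ℤ^d over ℤ. -/
def IsGenerator (d : ℕ) (I : Finset (Fin d → ℤ)) : Prop :=
  ∀ n : Fin d → ℤ, ∃ a : (Fin d → ℤ) → ℤ, n = ∑ k ∈ I, a k • k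

/-- Connectedness condition of Proposition 2.5. -/
def ConnectedSet (d : ℕ) (I : Finset (Fin d → ℤ)) : Prop :=
  ∀ l ∈ I, ∀ m ∈ I, ∃ k : ℕ, ∃ n : Fin (k + 1) → (Fin d → ℤ),
    (∀ j, n j ∈ I) ∧ ipZ d l (n 0) ≠ 0 ∧
    (∀ j : Fin k, ipZ d (n j.castSucc) (n j.succ) ≠ 0) ∧
    ipZ d (n (Fin.last k)) m ≠ 0

/-- (2πℤ^d)-periodicity for real-valued functions. -/
def Periodic2pi (d : ℕ) (f : (Fin d → ℝ) → ℝ) : Prop :=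
  ∀ (x : Fin d → ℝ) (k : Fin d → ℤ), f (x + fun j => 2 * Real.pi * (k j : ℝ)) = f x

/-! ### Derivatives of the trigonometric monomials -/

theorem hasFDerivAt_ip (d : ℕ) (m : Fin d → ℤ) (x : Fin d → ℝ) :
    HasFDerivAt (fun y => ip d y m)
      (∑ j, (m j : ℝ) • (ContinuousLinearMap.proj j : (Fin d → ℝ) →L[ℝ] ℝ)) x := by
  unfold ip
  refine HasFDerivAt.fun_sum fun j _ => ?_
  exact (ContinuousLinearMap.proj (R := ℝ) (φ := fun _ : Fin d => ℝ) j).hasFDerivAt.mul_const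
    (m j : ℝ)

theorem contDiff_ip (d : ℕ) (m : Fin d → ℤ) {n : WithTop ℕ∞} :
    ContDiff ℝ n (fun y => ip d y m) := by
  unfold ip
  fun_prop

theorem contDiff_cmap (d : ℕ) (m : Fin d → ℤ) {n : WithTop ℕ∞} : ContDiff ℝ n (cmap d m) :=
  Real.contDiff_cos.comp (contDiff_ip d m)

theorem contDiff_smap (d : ℕ) (m : Fin d → ℤ) {n : WithTop ℕ∞} : ContDiff ℝ n (smap d m) :=
  Real.contDiff_sin.comp (contDiff_ip d m)

theorem fderiv_cmap_single (d : ℕ) (m : Fin d → ℤ) (x : Fin d → ℝ) (i : Fin d) :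
    fderiv ℝ (cmap d m) x (Pi.single i 1) = -(m i : ℝ) * smap d m x := by
  have h := (hasFDerivAt_ip d m x).cos
  unfold cmap
  rw [h.fderiv]
  simp [smap, Pi.single_apply, mul_comm]

theorem fderiv_smap_single (d : ℕ) (m : Fin d → ℤ) (x : Fin d → ℝ) (i : Fin d) :
    fderiv ℝ (smap d m) x (Pi.single i 1) = (m i : ℝ) * cmap d m x := by
  have h := (hasFDerivAt_ip d m x).sin
  unfold smap
  rw [h.fderiv]
  simp [cmap, Pi.single_apply, mul_comm]

theorem ip_add (d : ℕ) (m l : Fin d → ℤ) (x : Fin d → ℝ) :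
    ip d x (m + l) = ip d x m + ip d x l := by
  simp [ip, mul_add, Finset.sum_add_distrib]

theorem ip_neg (d : ℕ) (m : Fin d → ℤ) (x : Fin d → ℝ) : ip d x (-m) = -ip d x m := by
  simp [ip]

theorem ip_zero (d : ℕ) (x : Fin d → ℝ) : ip d x 0 = 0 := by
  simp [ip]

/-! ### The operation `Fop` on linear subspaces -/

/-- The symmetric bilinear form polarising `Bop`. -/
noncomputable def gradInner (d : ℕ) (φ ψ : (Fin d → ℝ) → ℝ) : (Fin d → ℝ) → ℝ :=
  fun x => ∑ j, fderiv ℝ φ x (Pi.single j 1) * fderiv ℝ ψ x (Pi.single j 1)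

theorem Bop_zero (d : ℕ) : Bop d 0 = 0 := by
  ext x
  simp [Bop]

theorem Bop_smul (d : ℕ) (c : ℝ) (φ : (Fin d → ℝ) → ℝ) : Bop d (c • φ) = c ^ 2 • Bop d φ := by
  ext x
  simp [Bop, fderiv_const_smul_field, mul_pow, Finset.mul_sum]

theorem Bop_add (d : ℕ) {φ ψ : (Fin d → ℝ) → ℝ} (hφ : Differentiable ℝ φ)
    (hψ : Differentiable ℝ ψ) :
    Bop d (φ + ψ) = Bop d φ + Bop d ψ + (2 : ℝ) • gradInner d φ ψ := by
  ext x
  simp only [Bop, gradInner, fderiv_add (hφ x) (hψ x), Pi.add_apply, Pi.smul_apply, smul_eq_mul,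
    Finset.mul_sum, ← Finset.sum_add_distrib, _root_.add_apply]
  exact Finset.sum_congr rfl fun j _ => by ring

theorem gradInner_neg_right (d : ℕ) (φ ψ : (Fin d → ℝ) → ℝ) :
    gradInner d φ (-ψ) = -gradInner d φ ψ := by
  ext x
  simp [gradInner, fderiv_neg]

theorem BRep_self (d : ℕ) (S : Submodule ℝ ((Fin d → ℝ) → ℝ)) {f : (Fin d → ℝ) → ℝ}
    (hf : f ∈ S) : f ∈ BRep d S :=
  ⟨1, le_rfl, f, hf, fun _ => 0, fun _ => S.zero_mem, by simp [Bop_zero]⟩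

theorem BRep_add (d : ℕ) (S : Submodule ℝ ((Fin d → ℝ) → ℝ)) {f g : (Fin d → ℝ) → ℝ}
    (hf : f ∈ BRep d S) (hg : g ∈ BRep d S) : f + g ∈ BRep d S := by
  obtain ⟨n, hn, θ₀, hθ₀, θ, hθ, rfl⟩ := hf
  obtain ⟨m, -, η₀, hη₀, η, hη, rfl⟩ := hg
  refine ⟨n + m, by omega, θ₀ + η₀, S.add_mem hθ₀ hη₀, Fin.append θ η, fun j => ?_, ?_⟩
  · refine Fin.addCases (fun i => ?_) (fun i => ?_) j
    · simpa using hθ i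
    · simpa using hη i
  · rw [Fin.sum_univ_add]
    simp only [Fin.append_left, Fin.append_right]
    abel

theorem BRep_smul (d : ℕ) (S : Submodule ℝ ((Fin d → ℝ) → ℝ)) {c : ℝ} (hc : 0 ≤ c)
    {f : (Fin d → ℝ) → ℝ} (hf : f ∈ BRep d S) : c • f ∈ BRep d S := by
  obtain ⟨n, hn, θ₀, hθ₀, θ, hθ, rfl⟩ := hf
  refine ⟨n, hn, c • θ₀, S.smul_mem c hθ₀, fun j => √c • θ j, fun j => S.smul_mem _ (hθ j), ?_⟩
  simp only [Bop_smul, Real.sq_sqrt hc, smul_sub, Finset.smul_sum]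

/-- `Fop` of a linear subspace, as a linear subspace. -/
noncomputable def FSubmodule (d : ℕ) (S : Submodule ℝ ((Fin d → ℝ) → ℝ)) :
    Submodule ℝ ((Fin d → ℝ) → ℝ) where
  carrier := Fop d S
  zero_mem' := ⟨BRep_self d S S.zero_mem, by simpa using BRep_self d S S.zero_mem⟩
  add_mem' := fun {f g} hf hg =>
    ⟨BRep_add d S hf.1 hg.1, by rw [neg_add]; exact BRep_add d S hf.2 hg.2⟩
  smul_mem' := fun c f hf => by
    rcases le_total 0 c with hc | hc
    · exact ⟨BRep_smul d S hc hf.1, by rw [← smul_neg]; exact BRep_smul d S hc hf.2⟩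
    · have hc' : 0 ≤ -c := neg_nonneg.2 hc
      refine ⟨?_, ?_⟩
      · rw [← neg_smul_neg]; exact BRep_smul d S hc' hf.2
      · rw [← neg_smul]; exact BRep_smul d S hc' hf.1

theorem le_FSubmodule (d : ℕ) (S : Submodule ℝ ((Fin d → ℝ) → ℝ)) : S ≤ FSubmodule d S :=
  fun _ hf => ⟨BRep_self d S hf, BRep_self d S (S.neg_mem hf)⟩

theorem neg_two_smul_gradInner_mem_BRep (d : ℕ) (S : Submodule ℝ ((Fin d → ℝ) → ℝ))
    {φ φ' ψ ψ' : (Fin d → ℝ) → ℝ} (hφ : φ ∈ S) (hφ' : φ' ∈ S) (hψ : ψ ∈ S) (hψ' : ψ' ∈ S)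
    (dφ : Differentiable ℝ φ) (dψ : Differentiable ℝ ψ)
    (h1 : Bop d φ + Bop d φ' ∈ S) (h2 : Bop d ψ + Bop d ψ' ∈ S) :
    -((2 : ℝ) • gradInner d φ ψ) ∈ BRep d S := by
  refine ⟨3, by norm_num, _, S.add_mem h1 h2, ![φ + ψ, φ', ψ'], fun j => ?_, ?_⟩
  · fin_cases j
    exacts [S.add_mem hφ hψ, hφ', hψ']
  · simp only [Fin.sum_univ_three, Matrix.cons_val_zero, Matrix.cons_val_one, Matrix.cons_val]
    rw [Bop_add d dφ dψ]
    abel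

theorem gradInner_mem_FSubmodule (d : ℕ) (S : Submodule ℝ ((Fin d → ℝ) → ℝ))
    {φ φ' ψ ψ' : (Fin d → ℝ) → ℝ} (hφ : φ ∈ S) (hφ' : φ' ∈ S) (hψ : ψ ∈ S) (hψ' : ψ' ∈ S)
    (dφ : Differentiable ℝ φ) (dψ : Differentiable ℝ ψ)
    (h1 : Bop d φ + Bop d φ' ∈ S) (h2 : Bop d ψ + Bop d ψ' ∈ S) :
    gradInner d φ ψ ∈ FSubmodule d S := by
  have hneg := neg_two_smul_gradInner_mem_BRep d S hφ hφ' hψ hψ' dφ dψ h1 h2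
  have hBneg : Bop d (-ψ) = Bop d ψ := by
    rw [← neg_one_smul ℝ ψ, Bop_smul]; simp
  have hpos := neg_two_smul_gradInner_mem_BRep d S hφ hφ' (S.neg_mem hψ) hψ' dφ dψ.neg h1
    (by rwa [hBneg])
  rw [gradInner_neg_right, smul_neg, neg_neg] at hpos
  have h : (2 : ℝ) • gradInner d φ ψ ∈ FSubmodule d S := ⟨hpos, hneg⟩
  simpa using (FSubmodule d S).smul_mem (2⁻¹ : ℝ) h

/-! ### Frequencies reached by the iteration -/

/-- Both trigonometric monomials of frequency `m` belong to `S`. -/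
def IsFreq (d : ℕ) (S : Submodule ℝ ((Fin d → ℝ) → ℝ)) (m : Fin d → ℤ) : Prop :=
  cmap d m ∈ S ∧ smap d m ∈ S

theorem IsFreq.neg {d : ℕ} {S : Submodule ℝ ((Fin d → ℝ) → ℝ)} {m : Fin d → ℤ}
    (h : IsFreq d S m) : IsFreq d S (-m) := by
  have hc : cmap d (-m) = cmap d m := by ext x; simp [cmap, ip_neg]
  have hs : smap d (-m) = -smap d m := by ext x; simp [smap, ip_neg]
  exact ⟨hc ▸ h.1, hs ▸ S.neg_mem h.2⟩

theorem isFreq_zero {d : ℕ} {S : Submodule ℝ ((Fin d → ℝ) → ℝ)}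
    (h1 : (fun _ => (1 : ℝ)) ∈ S) : IsFreq d S 0 := by
  have hc : cmap d 0 = fun _ => (1 : ℝ) := by ext x; simp [cmap, ip_zero]
  have hs : smap d 0 = 0 := by ext x; simp [smap, ip_zero]
  exact ⟨hc ▸ h1, hs ▸ S.zero_mem⟩

theorem Bop_cmap_add_Bop_smap (d : ℕ) (m : Fin d → ℤ) :
    Bop d (cmap d m) + Bop d (smap d m) = (ipZ d m m : ℝ) • fun _ => (1 : ℝ) := by
  ext x
  simp only [Bop, Pi.add_apply, fderiv_cmap_single, fderiv_smap_single, Pi.smul_apply,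
    smul_eq_mul, mul_one, ipZ, Int.cast_sum, Int.cast_mul, ← Finset.sum_add_distrib]
  refine Finset.sum_congr rfl fun j _ => ?_
  have h : cmap d m x ^ 2 = 1 - smap d m x ^ 2 := Real.cos_sq' _
  linear_combination (m j : ℝ) ^ 2 * h

theorem IsFreq.add {d : ℕ} {S : Submodule ℝ ((Fin d → ℝ) → ℝ)} (hone : (fun _ => (1 : ℝ)) ∈ S)
    {m l : Fin d → ℤ} (hm : IsFreq d S m) (hl : IsFreq d S l) (hml : ipZ d m l ≠ 0) :
    IsFreq d (FSubmodule d S) (m + l) := by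
  have dc (k) : Differentiable ℝ (cmap d k) := (contDiff_cmap d k (n := 1)).differentiable (by simp)
  have ds (k) : Differentiable ℝ (smap d k) := (contDiff_smap d k (n := 1)).differentiable (by simp)
  have h1 (k) : Bop d (cmap d k) + Bop d (smap d k) ∈ S := by
    rw [Bop_cmap_add_Bop_smap]; exact S.smul_mem _ hone
  have h2 (k) : Bop d (smap d k) + Bop d (cmap d k) ∈ S := by
    rw [add_comm]; exact h1 k
  have hcc := gradInner_mem_FSubmodule d S hm.1 hm.2 hl.1 hl.2 (dc m) (dc l) (h1 m) (h1 l)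
  have hss := gradInner_mem_FSubmodule d S hm.2 hm.1 hl.2 hl.1 (ds m) (ds l) (h2 m) (h2 l)
  have hcs := gradInner_mem_FSubmodule d S hm.1 hm.2 hl.2 hl.1 (dc m) (ds l) (h1 m) (h2 l)
  have hsc := gradInner_mem_FSubmodule d S hm.2 hm.1 hl.1 hl.2 (ds m) (dc l) (h2 m) (h1 l)
  have hne : (ipZ d m l : ℝ) ≠ 0 := by exact_mod_cast hml
  constructor
  · convert (FSubmodule d S).smul_mem (ipZ d m l : ℝ)⁻¹ ((FSubmodule d S).sub_mem hss hcc) using 1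
    ext x
    simp only [Pi.smul_apply, Pi.sub_apply, smul_eq_mul]
    rw [eq_inv_mul_iff_mul_eq₀ hne]
    simp only [gradInner, fderiv_cmap_single, fderiv_smap_single, ← Finset.sum_sub_distrib, ipZ,
      Int.cast_sum, Int.cast_mul, Finset.sum_mul]
    refine Finset.sum_congr rfl fun j _ => ?_
    simp only [cmap, smap, ip_add, Real.cos_add]
    ring
  · convert (FSubmodule d S).smul_mem (-(ipZ d m l : ℝ)⁻¹)
      ((FSubmodule d S).add_mem hcs hsc) using 1
    ext x
    simp only [Pi.smul_apply, Pi.add_apply, smul_eq_mul]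
    rw [neg_mul, ← mul_neg, eq_inv_mul_iff_mul_eq₀ hne]
    simp only [gradInner, fderiv_cmap_single, fderiv_smap_single, ← Finset.sum_add_distrib, ipZ,
      Int.cast_sum, Int.cast_mul, Finset.sum_mul, ← Finset.sum_neg_distrib]
    refine Finset.sum_congr rfl fun j _ => ?_
    simp only [cmap, smap, ip_add, Real.sin_add]
    ring

/-- The spaces `HSeq`, as linear subspaces. -/
noncomputable def HSubmodule (d : ℕ) (I : Finset (Fin d → ℤ)) :
    ℕ → Submodule ℝ ((Fin d → ℝ) → ℝ)
  | 0 => Submodule.span ℝ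
      ({fun _ => (1 : ℝ)} ∪ ⋃ k ∈ (I : Set (Fin d → ℤ)), {cmap d k, smap d k})
  | j + 1 => FSubmodule d (HSubmodule d I j)

theorem coe_HSubmodule (d : ℕ) (I : Finset (Fin d → ℤ)) (j : ℕ) :
    (HSubmodule d I j : Set ((Fin d → ℝ) → ℝ)) = HSeq d I j := by
  induction j with
  | zero => rfl
  | succ j ih => rw [HSeq, ← ih]; rfl

theorem monotone_HSubmodule (d : ℕ) (I : Finset (Fin d → ℤ)) : Monotone (HSubmodule d I) :=
  monotone_nat_of_le_succ fun _ => le_FSubmodule d _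

theorem coe_iSup_HSubmodule (d : ℕ) (I : Finset (Fin d → ℤ)) :
    ((⨆ j, HSubmodule d I j : Submodule ℝ ((Fin d → ℝ) → ℝ)) : Set _) = Hinf d I := by
  rw [Submodule.coe_iSup_of_directed _ (monotone_HSubmodule d I).directed_le, Hinf]
  exact Set.iUnion_congr fun j => coe_HSubmodule d I j

theorem one_mem_HSubmodule (d : ℕ) (I : Finset (Fin d → ℤ)) (j : ℕ) :
    (fun _ => (1 : ℝ)) ∈ HSubmodule d I j :=
  monotone_HSubmodule d I (Nat.zero_le j) (Submodule.subset_span (Or.inl rfl))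

/-- The set of frequencies of trigonometric monomials contained in `Hinf`. -/
def freqSet (d : ℕ) (I : Finset (Fin d → ℤ)) : Set (Fin d → ℤ) :=
  {m | ∃ j, IsFreq d (HSubmodule d I j) m}

theorem zero_mem_freqSet (d : ℕ) (I : Finset (Fin d → ℤ)) : 0 ∈ freqSet d I :=
  ⟨0, isFreq_zero (one_mem_HSubmodule d I 0)⟩

theorem neg_mem_freqSet {d : ℕ} {I : Finset (Fin d → ℤ)} {m : Fin d → ℤ}
    (hm : m ∈ freqSet d I) : -m ∈ freqSet d I :=
  let ⟨j, h⟩ := hm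
  ⟨j, h.neg⟩

theorem mem_freqSet_of_mem {d : ℕ} {I : Finset (Fin d → ℤ)} {m : Fin d → ℤ} (hm : m ∈ I) :
    m ∈ freqSet d I := by
  refine ⟨0, Submodule.subset_span (Or.inr ?_), Submodule.subset_span (Or.inr ?_)⟩
  all_goals exact Set.mem_biUnion (Finset.mem_coe.2 hm) (by simp)

theorem add_mem_freqSet {d : ℕ} {I : Finset (Fin d → ℤ)} {m l : Fin d → ℤ}
    (hm : m ∈ freqSet d I) (hl : l ∈ freqSet d I) (hml : ipZ d m l ≠ 0) :
    m + l ∈ freqSet d I := by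
  obtain ⟨i, hi⟩ := hm
  obtain ⟨j, hj⟩ := hl
  have hi' := monotone_HSubmodule d I (le_max_left i j)
  have hj' := monotone_HSubmodule d I (le_max_right i j)
  exact ⟨max i j + 1, IsFreq.add (one_mem_HSubmodule d I _) ⟨hi' hi.1, hi' hi.2⟩
    ⟨hj' hj.1, hj' hj.2⟩ hml⟩

theorem ipZ_eq_dotProduct (d : ℕ) (m l : Fin d → ℤ) : ipZ d m l = m ⬝ᵥ l := rfl

theorem sub_mem_freqSet {d : ℕ} {I : Finset (Fin d → ℤ)} {m l : Fin d → ℤ}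
    (hm : m ∈ freqSet d I) (hl : l ∈ freqSet d I) (hml : ipZ d m l ≠ 0) :
    m - l ∈ freqSet d I := by
  rw [sub_eq_add_neg]
  refine add_mem_freqSet hm (neg_mem_freqSet hl) ?_
  rw [ipZ_eq_dotProduct] at hml ⊢
  simpa using hml

/-- Two frequencies with a common non-orthogonal frequency can be added. -/
theorem add_mem_freqSet_of_common {d : ℕ} {I : Finset (Fin d → ℤ)} {m l n : Fin d → ℤ}
    (hm : m ∈ freqSet d I) (hl : l ∈ freqSet d I) (hn : n ∈ freqSet d I)
    (hmn : ipZ d m n ≠ 0) (hln : ipZ d l n ≠ 0) : m + l ∈ freqSet d I := by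
  by_cases h0 : ipZ d m l = 0
  · by_cases h : ipZ d (m + n) (l - n) = 0
    · rw [show m + l = (m - n) + (l + n) by abel]
      refine add_mem_freqSet (sub_mem_freqSet hm hn hmn) (add_mem_freqSet hl hn hln) ?_
      have hnn : ipZ d n n ≠ 0 := by
        intro h0
        rw [ipZ_eq_dotProduct, dotProduct_self_eq_zero] at h0
        simp [h0, ipZ_eq_dotProduct] at hmn
      simp only [ipZ_eq_dotProduct, add_dotProduct, sub_dotProduct, dotProduct_add,
        dotProduct_sub, dotProduct_comm n l] at *
      omega
    · rw [show m + l = (m + n) + (l - n) by abel]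
      exact add_mem_freqSet (add_mem_freqSet hm hn hmn) (sub_mem_freqSet hl hn hln) h
  · exact add_mem_freqSet hm hl h0

/-- Two elements which are both non-orthogonal to some frequency of `freqSet`. -/
def Linked (d : ℕ) (I : Finset (Fin d → ℤ)) (m l : Fin d → ℤ) : Prop :=
  ∃ n ∈ freqSet d I, ipZ d m n ≠ 0 ∧ ipZ d n l ≠ 0

theorem ipZ_comm (d : ℕ) (m l : Fin d → ℤ) : ipZ d m l = ipZ d l m := dotProduct_comm m l

theorem Linked.step {d : ℕ} {I : Finset (Fin d → ℤ)} {m l p : Fin d → ℤ} (h : Linked d I m l)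
    (hl : l ∈ freqSet d I) (hlp : ipZ d l p ≠ 0) : Linked d I m p := by
  obtain ⟨n, hn, hmn, hnl⟩ := h
  by_cases h1 : ipZ d n p = 0
  · by_cases h2 : ipZ d m l = 0
    · refine ⟨n + l, add_mem_freqSet hn hl hnl, ?_, ?_⟩
      all_goals
        simp only [ipZ_eq_dotProduct, add_dotProduct, dotProduct_add] at *
        omega
    · exact ⟨l, hl, h2, hlp⟩
  · exact ⟨n, hn, hmn, h1⟩

theorem exists_ipZ_ne_zero {d : ℕ} {I : Finset (Fin d → ℤ)} (hgen : IsGenerator d I)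
    {m : Fin d → ℤ} (hm : m ≠ 0) : ∃ k ∈ I, ipZ d m k ≠ 0 := by
  by_contra! h
  obtain ⟨a, ha⟩ := hgen m
  refine hm (dotProduct_self_eq_zero.1 ?_)
  nth_rewrite 2 [ha]
  rw [dotProduct_sum]
  refine Finset.sum_eq_zero fun k hk => ?_
  rw [dotProduct_smul, ← ipZ_eq_dotProduct, h k hk, smul_zero]

theorem linked_of_connectedSet {d : ℕ} {I : Finset (Fin d → ℤ)} (hgen : IsGenerator d I)
    (hconn : ConnectedSet d I) {m l : Fin d → ℤ} (hm : m ≠ 0) (hl : l ∈ I) :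
    Linked d I m l := by
  obtain ⟨k, hk, hmk⟩ := exists_ipZ_ne_zero hgen hm
  obtain ⟨N, n, hn, h0, hstep, hlast⟩ := hconn k hk l hl
  have hlink : ∀ j : Fin (N + 1), Linked d I m (n j) := by
    intro j
    induction j using Fin.induction with
    | zero => exact ⟨k, mem_freqSet_of_mem hk, hmk, h0⟩
    | succ j ih => exact ih.step (mem_freqSet_of_mem (hn _)) (hstep j)
  exact (hlink _).step (mem_freqSet_of_mem (hn _)) hlast

theorem add_mem_freqSet_of_mem {d : ℕ} {I : Finset (Fin d → ℤ)} (hgen : IsGenerator d I)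
    (hconn : ConnectedSet d I) {m l : Fin d → ℤ} (hm : m ∈ freqSet d I) (hl : l ∈ I) :
    m + l ∈ freqSet d I := by
  rcases eq_or_ne m 0 with rfl | hm0
  · simpa using mem_freqSet_of_mem hl
  · obtain ⟨n, hn, hmn, hnl⟩ := linked_of_connectedSet hgen hconn hm0 hl
    exact add_mem_freqSet_of_common hm (mem_freqSet_of_mem hl) hn hmn (by rwa [ipZ_comm])

theorem add_zsmul_mem_freqSet {d : ℕ} {I : Finset (Fin d → ℤ)} (hgen : IsGenerator d I)
    (hconn : ConnectedSet d I) {m l : Fin d → ℤ} (hm : m ∈ freqSet d I) (hl : l ∈ I) (a : ℤ) :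
    m + a • l ∈ freqSet d I := by
  induction a with
  | zero => simpa using hm
  | succ a ih =>
    rw [add_smul, one_smul, ← add_assoc]
    exact add_mem_freqSet_of_mem hgen hconn ih hl
  | pred a ih =>
    have h := neg_mem_freqSet (add_mem_freqSet_of_mem hgen hconn (neg_mem_freqSet ih) hl)
    rw [sub_smul, one_smul]
    convert h using 1
    abel

theorem mem_freqSet {d : ℕ} {I : Finset (Fin d → ℤ)} (hgen : IsGenerator d I)
    (hconn : ConnectedSet d I) (m : Fin d → ℤ) : m ∈ freqSet d I := by
  obtain ⟨a, rfl⟩ := hgen m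
  suffices ∀ J ⊆ I, ∑ k ∈ J, a k • k ∈ freqSet d I from this I subset_rfl
  intro J
  induction J using Finset.induction_on with
  | empty => exact fun _ => zero_mem_freqSet d I
  | insert k J hk ih =>
    intro hJ
    rw [Finset.sum_insert hk, add_comm]
    exact add_zsmul_mem_freqSet hgen hconn (ih ((Finset.subset_insert k J).trans hJ))
      (hJ (Finset.mem_insert_self k J)) (a k)

/-! ### Smooth periodic functions and the operators `1 + ∂ᵢ` -/

/-- The partial derivative `∂ᵢ`. -/
noncomputable def pderivFun {d : ℕ} (i : Fin d) (u : (Fin d → ℝ) → ℝ) : (Fin d → ℝ) → ℝ :=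
  fun x => fderiv ℝ u x (Pi.single i 1)

/-- The operator `1 + ∂ᵢ`. -/
noncomputable def addPderiv {d : ℕ} (i : Fin d) (u : (Fin d → ℝ) → ℝ) : (Fin d → ℝ) → ℝ :=
  u + pderivFun i u

/-- The composition of the operators `1 + ∂ᵢ` for `i` in the list `L`. -/
noncomputable def addPderivs {d : ℕ} (L : List (Fin d)) (u : (Fin d → ℝ) → ℝ) :
    (Fin d → ℝ) → ℝ :=
  L.foldr addPderiv u

/-- The space of smooth periodic functions. -/
def smoothPeriodic (d : ℕ) : Submodule ℝ ((Fin d → ℝ) → ℝ) where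
  carrier := {u | ContDiff ℝ (⊤ : ℕ∞) u ∧ Periodic2pi d u}
  zero_mem' := ⟨contDiff_const, fun _ _ => rfl⟩
  add_mem' := fun hu hv => ⟨hu.1.add hv.1, fun x k => congrArg₂ (· + ·) (hu.2 x k) (hv.2 x k)⟩
  smul_mem' := fun c _ hu => ⟨contDiff_const.smul hu.1, fun x k => congrArg (c • ·) (hu.2 x k)⟩

section

variable {d : ℕ} {u v : (Fin d → ℝ) → ℝ}

theorem differentiable_of_mem (hu : u ∈ smoothPeriodic d) : Differentiable ℝ u :=
  hu.1.differentiable (by simp)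

theorem pderivFun_mem (i : Fin d) (hu : u ∈ smoothPeriodic d) :
    pderivFun i u ∈ smoothPeriodic d := by
  refine ⟨(hu.1.fderiv_right (m := (⊤ : ℕ∞)) (by simp)).clm_apply contDiff_const,
    fun x k => ?_⟩
  have h : (fun y => u (y + fun j => 2 * Real.pi * (k j : ℝ))) = u := funext fun y => hu.2 y k
  rw [pderivFun, ← fderiv_comp_add_right, h, pderivFun]

theorem pderivFun_add (i : Fin d) (hu : Differentiable ℝ u) (hv : Differentiable ℝ v) :
    pderivFun i (u + v) = pderivFun i u + pderivFun i v := by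
  ext x
  simp [pderivFun, fderiv_add (hu x) (hv x)]

theorem pderivFun_smul (i : Fin d) (c : ℝ) (u : (Fin d → ℝ) → ℝ) :
    pderivFun i (c • u) = c • pderivFun i u := by
  ext x
  simp [pderivFun, fderiv_const_smul_field]

theorem pderivFun_comm (i j : Fin d) (hu : u ∈ smoothPeriodic d) :
    pderivFun i (pderivFun j u) = pderivFun j (pderivFun i u) := by
  have h2 : Differentiable ℝ (fderiv ℝ u) :=
    (hu.1.fderiv_right (m := (⊤ : ℕ∞)) (by simp)).differentiable (by simp)
  have key (i j : Fin d) (x : Fin d → ℝ) : pderivFun i (pderivFun j u) x =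
      fderiv ℝ (fderiv ℝ u) x (Pi.single i 1) (Pi.single j 1) := by
    unfold pderivFun
    rw [fderiv_clm_apply (h2 x) (differentiableAt_const _)]
    simp
  have hu2 : ContDiff ℝ (2 : ℕ) u := contDiff_infty.1 hu.1 2
  ext x
  rw [key, key]
  exact (hu2.contDiffAt.isSymmSndFDerivAt (by simp)).eq _ _

theorem addPderiv_mem (i : Fin d) (hu : u ∈ smoothPeriodic d) :
    addPderiv i u ∈ smoothPeriodic d :=
  (smoothPeriodic d).add_mem hu (pderivFun_mem i hu)

theorem addPderivs_mem (L : List (Fin d)) (hu : u ∈ smoothPeriodic d) :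
    addPderivs L u ∈ smoothPeriodic d := by
  induction L with
  | nil => exact hu
  | cons i L ih => exact addPderiv_mem i ih

theorem addPderiv_add (i : Fin d) (hu : Differentiable ℝ u) (hv : Differentiable ℝ v) :
    addPderiv i (u + v) = addPderiv i u + addPderiv i v := by
  rw [addPderiv, pderivFun_add i hu hv, addPderiv, addPderiv]
  abel

theorem addPderiv_smul (i : Fin d) (c : ℝ) (u : (Fin d → ℝ) → ℝ) :
    addPderiv i (c • u) = c • addPderiv i u := by
  rw [addPderiv, pderivFun_smul, addPderiv, smul_add]

theorem addPderivs_sub (L : List (Fin d)) (hu : u ∈ smoothPeriodic d)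
    (hv : v ∈ smoothPeriodic d) :
    addPderivs L (u - v) = addPderivs L u - addPderivs L v := by
  induction L with
  | nil => rfl
  | cons i L ih =>
    change addPderiv i (addPderivs L (u - v)) =
      addPderiv i (addPderivs L u) - addPderiv i (addPderivs L v)
    have hv' := addPderivs_mem L hv
    rw [ih, sub_eq_add_neg, ← neg_one_smul ℝ, addPderiv_add i
      (differentiable_of_mem (addPderivs_mem L hu))
      (differentiable_of_mem ((smoothPeriodic d).smul_mem _ hv')), addPderiv_smul, neg_one_smul,
      ← sub_eq_add_neg]

theorem pderivFun_addPderivs (i : Fin d) (L : List (Fin d)) (hu : u ∈ smoothPeriodic d) :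
    pderivFun i (addPderivs L u) = addPderivs L (pderivFun i u) := by
  induction L with
  | nil => rfl
  | cons j L ih =>
    change pderivFun i (addPderiv j (addPderivs L u)) =
      addPderiv j (addPderivs L (pderivFun i u))
    have h := addPderivs_mem L hu
    rw [addPderiv, pderivFun_add i (differentiable_of_mem h)
      (differentiable_of_mem (pderivFun_mem j h)), pderivFun_comm i j h, ih, addPderiv]

theorem le_of_addPderiv_le {i : Fin d} (hu : u ∈ smoothPeriodic d) {δ : ℝ}
    (h : ∀ x, addPderiv i u x ≤ δ) (x : Fin d → ℝ) : u x ≤ δ := by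
  let γ : ℝ → Fin d → ℝ := fun t => x + t • Pi.single i 1
  have hγ (t : ℝ) : HasDerivAt γ (Pi.single i 1) t := by
    have h := ((hasDerivAt_id t).smul_const (Pi.single i (1 : ℝ) : Fin d → ℝ)).const_add x
    rwa [one_smul] at h
  have hw (t : ℝ) : HasDerivAt (fun t => Real.exp t * (u (γ t) - δ))
      (Real.exp t * (addPderiv i u (γ t) - δ)) t := by
    have h1 := ((differentiable_of_mem hu (γ t)).hasFDerivAt.comp_hasDerivAt t (hγ t)).sub_const δ
    refine ((Real.hasDerivAt_exp t).mul h1).congr_deriv ?_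
    simp only [addPderiv, pderivFun, Pi.add_apply, Function.comp_apply]
    ring
  have hanti : Antitone (fun t => Real.exp t * (u (γ t) - δ)) :=
    antitone_of_hasDerivAt_nonpos hw fun t =>
      mul_nonpos_of_nonneg_of_nonpos (Real.exp_pos t).le (sub_nonpos.2 (h _))
  have hle := hanti (show (0 : ℝ) ≤ 2 * Real.pi by positivity)
  have hper : u (γ (2 * Real.pi)) = u x := by
    rw [← hu.2 x (Pi.single i 1)]
    congr 1
    ext j
    by_cases hj : j = i
    · subst hj; simp [γ]
    · simp [γ, hj]
  have h0 : γ 0 = x := by simp [γ]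
  simp only [hper, h0, Real.exp_zero, one_mul] at hle
  have hexp : 1 < Real.exp (2 * Real.pi) := Real.one_lt_exp_iff.2 (by positivity)
  nlinarith

theorem abs_le_of_abs_addPderiv_le {i : Fin d} (hu : u ∈ smoothPeriodic d) {δ : ℝ}
    (h : ∀ x, |addPderiv i u x| ≤ δ) (x : Fin d → ℝ) : |u x| ≤ δ := by
  refine abs_le'.2 ⟨le_of_addPderiv_le hu (fun y => (abs_le'.1 (h y)).1) x, ?_⟩
  refine le_of_addPderiv_le (i := i) ((smoothPeriodic d).neg_mem hu) (fun y => ?_) x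
  rw [← neg_one_smul ℝ, addPderiv_smul, neg_one_smul]
  exact (abs_le'.1 (h y)).2

theorem abs_le_of_abs_addPderivs_le {L : List (Fin d)} (hu : u ∈ smoothPeriodic d) {δ : ℝ}
    (h : ∀ x, |addPderivs L u x| ≤ δ) : ∀ x, |u x| ≤ δ := by
  induction L with
  | nil => exact h
  | cons i L ih => exact ih (abs_le_of_abs_addPderiv_le (addPderivs_mem L hu) h)

theorem abs_pderivFun_le_of_abs_addPderivs_le {L : List (Fin d)} {i : Fin d} (hi : i ∈ L)
    (hu : u ∈ smoothPeriodic d) {δ : ℝ} (h : ∀ x, |addPderivs L u x| ≤ δ) :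
    ∀ x, |pderivFun i u x| ≤ 2 * δ := by
  induction L with
  | nil => simp at hi
  | cons j L ih =>
    have hv := abs_le_of_abs_addPderiv_le (addPderivs_mem L hu) h
    rcases List.mem_cons.1 hi with rfl | hi
    · refine abs_le_of_abs_addPderivs_le (L := L) (pderivFun_mem i hu) fun x => ?_
      rw [← pderivFun_addPderivs i L hu]
      have h1 : |addPderivs L u x + pderivFun i (addPderivs L u) x| ≤ δ := h x
      have h2 := hv x
      rw [abs_le] at *
      constructor <;> linarith
    · exact ih hi hv

/-- All partial derivatives of `u` of order at most `k` are bounded by `C`. -/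
def PartialsBounded {d : ℕ} : ℕ → ℝ → ((Fin d → ℝ) → ℝ) → Prop
  | 0, C, u => ∀ x, |u x| ≤ C
  | k + 1, C, u => (∀ x, |u x| ≤ C) ∧ ∀ i, PartialsBounded k C (pderivFun i u)

theorem PartialsBounded.abs_le {k : ℕ} {C : ℝ} (h : PartialsBounded k C u) (x : Fin d → ℝ) :
    |u x| ≤ C := by
  cases k with
  | zero => exact h x
  | succ k => exact h.1 x

theorem PartialsBounded.succ {k : ℕ} {δ : ℝ} (hu : u ∈ smoothPeriodic d)
    (h : PartialsBounded k δ (addPderivs (List.finRange d) u)) :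
    PartialsBounded (k + 1) (2 * δ) u := by
  have h0 := abs_le_of_abs_addPderivs_le hu h.abs_le
  have hδ : 0 ≤ δ := (abs_nonneg _).trans (h0 0)
  refine ⟨fun x => (h0 x).trans (by linarith), fun i => ?_⟩
  induction k generalizing u i with
  | zero => exact abs_pderivFun_le_of_abs_addPderivs_le (List.mem_finRange i) hu h
  | succ k ih =>
    refine ⟨abs_pderivFun_le_of_abs_addPderivs_le (List.mem_finRange i) hu h.1, ?_⟩
    have hi := pderivFun_mem i hu
    have h' := h.2 i
    rw [pderivFun_addPderivs i _ hu] at h'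
    exact ih hi h' (abs_le_of_abs_addPderivs_le hi h'.abs_le)

theorem fderiv_eq_sum_pderivFun (u : (Fin d → ℝ) → ℝ) :
    fderiv ℝ u = fun x => ∑ i, ContinuousLinearMap.toSpanSingleton ℝ
      (ContinuousLinearMap.proj i : (Fin d → ℝ) →L[ℝ] ℝ) (pderivFun i u x) := by
  ext x v
  conv_lhs => rw [← Finset.univ_sum_single v]
  rw [map_sum]
  simp only [_root_.sum_apply, ContinuousLinearMap.toSpanSingleton_apply,
    _root_.smul_apply, ContinuousLinearMap.proj_apply, smul_eq_mul, pderivFun]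
  refine Finset.sum_congr rfl fun i _ => ?_
  rw [show (Pi.single i (v i) : Fin d → ℝ) = v i • Pi.single i 1 by
    rw [← Pi.single_smul, smul_eq_mul, mul_one], map_smul, smul_eq_mul, mul_comm]

theorem PartialsBounded.norm_iteratedFDeriv_le {k : ℕ} {C : ℝ} (hu : u ∈ smoothPeriodic d)
    (h : PartialsBounded k C u) {j : ℕ} (hj : j ≤ k) (x : Fin d → ℝ) :
    ‖iteratedFDeriv ℝ j u x‖ ≤ (d : ℝ) ^ j * C := by
  induction j generalizing k u with
  | zero => simpa using h.abs_le x
  | succ j ih =>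
    obtain ⟨k, rfl⟩ : ∃ k', k = k' + 1 := ⟨k - 1, by omega⟩
    rw [← norm_iteratedFDeriv_fderiv, fderiv_eq_sum_pderivFun]
    have hsm (i : Fin d) : ContDiff ℝ j (pderivFun i u) :=
      contDiff_infty.1 (pderivFun_mem i hu).1 j
    let T (i : Fin d) : ℝ →L[ℝ] (Fin d → ℝ) →L[ℝ] ℝ :=
      ContinuousLinearMap.toSpanSingleton ℝ (ContinuousLinearMap.proj i)
    have hT (i : Fin d) : ‖T i‖ ≤ 1 := by
      rw [ContinuousLinearMap.norm_toSpanSingleton]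
      refine ContinuousLinearMap.opNorm_le_bound _ zero_le_one fun v => ?_
      simpa using norm_le_pi_norm v i
    have hterm (i : Fin d) : ‖iteratedFDeriv ℝ j (fun y => T i (pderivFun i u y)) x‖ ≤
        (d : ℝ) ^ j * C :=
      ((T i).norm_iteratedFDeriv_comp_left (hsm i).contDiffAt le_rfl).trans <|
        (mul_le_of_le_one_left (norm_nonneg _) (hT i)).trans
          (ih (pderivFun_mem i hu) (h.2 i) (by omega))
    rw [iteratedFDeriv_fun_sum_apply (f := fun i y => T i (pderivFun i u y))
      fun i _ => ((T i).contDiff.comp (hsm i)).contDiffAt]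
    refine (norm_sum_le _ _).trans ((Finset.sum_le_sum fun i _ => hterm i).trans ?_)
    simp only [Finset.sum_const, Finset.card_univ, Fintype.card_fin, nsmul_eq_mul]
    rw [pow_succ]
    exact le_of_eq (by ring)

end

/-! ### Trigonometric polynomials -/

/-- The space of real trigonometric polynomials. -/
noncomputable def trigPoly (d : ℕ) : Submodule ℝ ((Fin d → ℝ) → ℝ) :=
  Submodule.span ℝ (Set.range (cmap d) ∪ Set.range (smap d))

theorem cmap_mem_trigPoly (d : ℕ) (m : Fin d → ℤ) : cmap d m ∈ trigPoly d :=
  Submodule.subset_span (Or.inl ⟨m, rfl⟩)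

theorem smap_mem_trigPoly (d : ℕ) (m : Fin d → ℤ) : smap d m ∈ trigPoly d :=
  Submodule.subset_span (Or.inr ⟨m, rfl⟩)

theorem ip_add_period (d : ℕ) (m k : Fin d → ℤ) (x : Fin d → ℝ) :
    ip d (x + fun j => 2 * Real.pi * (k j : ℝ)) m =
      ip d x m + (ipZ d k m : ℤ) * (2 * Real.pi) := by
  simp only [ip, ipZ, Pi.add_apply, add_mul, Finset.sum_add_distrib, Int.cast_sum, Int.cast_mul,
    Finset.sum_mul]
  congr 1
  exact Finset.sum_congr rfl fun j _ => by ring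

theorem trigPoly_le_smoothPeriodic (d : ℕ) : trigPoly d ≤ smoothPeriodic d := by
  refine Submodule.span_le.2 ?_
  rintro _ (⟨m, rfl⟩ | ⟨m, rfl⟩)
  · exact ⟨contDiff_cmap d m, fun x k => by
      simp only [cmap, ip_add_period, Real.cos_add_int_mul_two_pi]⟩
  · exact ⟨contDiff_smap d m, fun x k => by
      simp only [smap, ip_add_period, Real.sin_add_int_mul_two_pi]⟩

theorem addPderiv_cmap {d : ℕ} (i : Fin d) (m : Fin d → ℤ) :
    addPderiv i (cmap d m) = cmap d m - (m i : ℝ) • smap d m := by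
  ext x
  simp [addPderiv, pderivFun, fderiv_cmap_single, sub_eq_add_neg]

theorem addPderiv_smap {d : ℕ} (i : Fin d) (m : Fin d → ℤ) :
    addPderiv i (smap d m) = smap d m + (m i : ℝ) • cmap d m := by
  ext x
  simp [addPderiv, pderivFun, fderiv_smap_single]

theorem exists_addPderiv_eq {d : ℕ} (i : Fin d) {q : (Fin d → ℝ) → ℝ} (hq : q ∈ trigPoly d) :
    ∃ p ∈ trigPoly d, addPderiv i p = q := by
  have hdiff {p} (hp : p ∈ trigPoly d) : Differentiable ℝ p :=
    differentiable_of_mem (trigPoly_le_smoothPeriodic d hp)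
  have hS {c p} (hp : p ∈ trigPoly d) : c • p ∈ trigPoly d := (trigPoly d).smul_mem c hp
  induction hq using Submodule.span_induction with
  | mem q hq =>
    have hm (m : Fin d → ℤ) : (1 + (m i : ℝ) ^ 2) ≠ 0 := by positivity
    rcases hq with ⟨m, rfl⟩ | ⟨m, rfl⟩
    · refine ⟨(1 + (m i : ℝ) ^ 2)⁻¹ • (cmap d m + (m i : ℝ) • smap d m),
        hS ((trigPoly d).add_mem (cmap_mem_trigPoly d m) (hS (smap_mem_trigPoly d m))), ?_⟩
      rw [addPderiv_smul, addPderiv_add i (hdiff (cmap_mem_trigPoly d m))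
        (hdiff (hS (smap_mem_trigPoly d m))), addPderiv_smul, addPderiv_cmap, addPderiv_smap,
        inv_smul_eq_iff₀ (hm m)]
      module
    · refine ⟨(1 + (m i : ℝ) ^ 2)⁻¹ • (smap d m + (-(m i : ℝ)) • cmap d m),
        hS ((trigPoly d).add_mem (smap_mem_trigPoly d m) (hS (cmap_mem_trigPoly d m))), ?_⟩
      rw [addPderiv_smul, addPderiv_add i (hdiff (smap_mem_trigPoly d m))
        (hdiff (hS (cmap_mem_trigPoly d m))), addPderiv_smul, addPderiv_cmap, addPderiv_smap,
        inv_smul_eq_iff₀ (hm m)]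
      module
  | zero => exact ⟨0, (trigPoly d).zero_mem, by simpa using addPderiv_smul i 0 0⟩
  | add q q' _ _ ih ih' =>
    obtain ⟨p, hp, rfl⟩ := ih
    obtain ⟨p', hp', rfl⟩ := ih'
    exact ⟨p + p', (trigPoly d).add_mem hp hp', addPderiv_add i (hdiff hp) (hdiff hp')⟩
  | smul c q _ ih =>
    obtain ⟨p, hp, rfl⟩ := ih
    exact ⟨c • p, hS hp, addPderiv_smul i c p⟩

theorem exists_addPderivs_eq {d : ℕ} (L : List (Fin d)) {q : (Fin d → ℝ) → ℝ}
    (hq : q ∈ trigPoly d) : ∃ p ∈ trigPoly d, addPderivs L p = q := by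
  induction L generalizing q with
  | nil => exact ⟨q, hq, rfl⟩
  | cons i L ih =>
    obtain ⟨q', hq', rfl⟩ := exists_addPderiv_eq i hq
    obtain ⟨p, hp, rfl⟩ := ih hq'
    exact ⟨p, hp, rfl⟩

/-! ### Uniform approximation by trigonometric polynomials -/

/-- The map `x ↦ x / 2π` from `ℝ^d` to the torus with unit periods. -/
noncomputable def toUnitTorus (d : ℕ) (x : Fin d → ℝ) : UnitAddTorus (Fin d) :=
  fun j => ((x j / (2 * Real.pi) : ℝ) : UnitAddCircle)

theorem mFourier_toUnitTorus (d : ℕ) (m : Fin d → ℤ) (x : Fin d → ℝ) :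
    UnitAddTorus.mFourier m (toUnitTorus d x) = Complex.exp ((ip d x m : ℝ) * Complex.I) := by
  simp only [UnitAddTorus.mFourier, ContinuousMap.coe_mk, toUnitTorus, fourier_coe_apply, ip,
    ← Complex.exp_sum, Complex.ofReal_sum, Finset.sum_mul]
  congr 1
  refine Finset.sum_congr rfl fun j _ => ?_
  have : (Real.pi : ℂ) ≠ 0 := by exact_mod_cast Real.pi_ne_zero
  push_cast
  field_simp

theorem re_comp_toUnitTorus_mem_trigPoly (d : ℕ) {P : C(UnitAddTorus (Fin d), ℂ)}
    (hP : P ∈ Submodule.span ℂ (Set.range (UnitAddTorus.mFourier (d := Fin d)))) :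
    (fun x => (P (toUnitTorus d x)).re) ∈ trigPoly d := by
  suffices h : ∀ c : ℂ, (fun x => (c * P (toUnitTorus d x)).re) ∈ trigPoly d by
    simpa using h 1
  induction hP using Submodule.span_induction with
  | mem P hP =>
    obtain ⟨m, rfl⟩ := hP
    intro c
    convert (trigPoly d).sub_mem ((trigPoly d).smul_mem c.re (cmap_mem_trigPoly d m))
      ((trigPoly d).smul_mem c.im (smap_mem_trigPoly d m)) using 1
    ext x
    rw [mFourier_toUnitTorus, Complex.mul_re, Complex.exp_ofReal_mul_I_re,
      Complex.exp_ofReal_mul_I_im]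
    rfl
  | zero =>
    intro c
    convert (trigPoly d).zero_mem using 1
    ext x
    simp
  | add P Q _ _ hP hQ =>
    intro c
    convert (trigPoly d).add_mem (hP c) (hQ c) using 1
    ext x
    simp [mul_add]
  | smul a P _ hP =>
    intro c
    convert hP (c * a) using 1
    ext x
    simp [mul_assoc]

theorem exists_continuousMap_comp_toUnitTorus {d : ℕ} {u : (Fin d → ℝ) → ℝ} (hc : Continuous u)
    (hp : Periodic2pi d u) :
    ∃ F : C(UnitAddTorus (Fin d), ℂ), ∀ x, F (toUnitTorus d x) = (u x : ℂ) := by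
  have hq : IsOpenQuotientMap
      (Pi.map fun _ : Fin d => ((↑) : ℝ → UnitAddCircle)) :=
    IsOpenQuotientMap.piMap fun _ => QuotientAddGroup.isOpenQuotientMap_mk
  let π' : C(Fin d → ℝ, UnitAddTorus (Fin d)) := ⟨_, hq.continuous⟩
  have hπ : Topology.IsQuotientMap π' := hq.isQuotientMap
  let g : C(Fin d → ℝ, ℂ) := ⟨fun y => (u ((2 * Real.pi) • y) : ℂ), by fun_prop⟩
  have hg : Function.FactorsThrough g π' := by
    intro a b hab
    have h (j : Fin d) : ∃ n : ℤ, a j = b j + n := by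
      have hj : (a j : UnitAddCircle) = b j := congrFun hab j
      obtain ⟨n, hn⟩ := (AddCircle.coe_eq_zero_iff (p := (1 : ℝ)) (x := a j - b j)).1
        (by rw [AddCircle.coe_sub, hj, sub_self])
      exact ⟨n, by simp at hn; linarith⟩
    choose k hk using h
    have hab' : (2 * Real.pi) • a = (2 * Real.pi) • b + fun j => 2 * Real.pi * (k j : ℝ) := by
      ext j
      simp [hk j, mul_add]
    change (u _ : ℂ) = (u _ : ℂ)
    rw [hab', hp]
  refine ⟨hπ.lift g hg, fun x => ?_⟩
  have hx : toUnitTorus d x = π' (fun j => x j / (2 * Real.pi)) := rfl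
  have hlift : hπ.lift g hg (π' (fun j => x j / (2 * Real.pi))) = g _ :=
    DFunLike.congr_fun (hπ.lift_comp g hg) _
  rw [hx, hlift]
  change (u _ : ℂ) = _
  congr 2
  ext j
  simp only [Pi.smul_apply, smul_eq_mul]
  exact mul_div_cancel₀ _ (by positivity)

theorem exists_trigPoly_abs_sub_le {d : ℕ} {u : (Fin d → ℝ) → ℝ} (hc : Continuous u)
    (hp : Periodic2pi d u) {ε : ℝ} (hε : 0 < ε) :
    ∃ p ∈ trigPoly d, ∀ x, |u x - p x| ≤ ε := by
  obtain ⟨F, hF⟩ := exists_continuousMap_comp_toUnitTorus hc hp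
  have hmem : F ∈ closure (Submodule.span ℂ
      (Set.range (UnitAddTorus.mFourier (d := Fin d))) : Set C(UnitAddTorus (Fin d), ℂ)) := by
    rw [← Submodule.topologicalClosure_coe, UnitAddTorus.span_mFourier_closure_eq_top]
    trivial
  obtain ⟨P, hP, hdist⟩ := Metric.mem_closure_iff.1 hmem ε hε
  refine ⟨_, re_comp_toUnitTorus_mem_trigPoly d hP, fun x => ?_⟩
  have h1 := (ContinuousMap.dist_apply_le_dist (f := F) (g := P) (toUnitTorus d x)).trans hdist.le
  rw [hF, dist_eq_norm] at h1
  simpa using (Complex.abs_re_le_norm _).trans h1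

theorem exists_trigPoly_partialsBounded {d : ℕ} (k : ℕ) {u : (Fin d → ℝ) → ℝ}
    (hu : u ∈ smoothPeriodic d) {ε : ℝ} (hε : 0 < ε) :
    ∃ p ∈ trigPoly d, PartialsBounded k ε (u - p) := by
  induction k generalizing u ε with
  | zero => exact exists_trigPoly_abs_sub_le hu.1.continuous hu.2 hε
  | succ k ih =>
    obtain ⟨q, hq, hbd⟩ := ih (addPderivs_mem (List.finRange d) hu) (half_pos hε)
    obtain ⟨p, hp, rfl⟩ := exists_addPderivs_eq (List.finRange d) hq
    have hp' := trigPoly_le_smoothPeriodic d hp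
    rw [← addPderivs_sub _ hu hp'] at hbd
    refine ⟨p, hp, ?_⟩
    simpa [mul_div_cancel₀] using hbd.succ ((smoothPeriodic d).sub_mem hu hp')

theorem trigPoly_le_iSup_HSubmodule {d : ℕ} {I : Finset (Fin d → ℤ)} (hgen : IsGenerator d I)
    (hconn : ConnectedSet d I) : trigPoly d ≤ ⨆ j, HSubmodule d I j := by
  refine Submodule.span_le.2 ?_
  rintro _ (⟨m, rfl⟩ | ⟨m, rfl⟩)
  all_goals
    obtain ⟨j, hj⟩ := mem_freqSet hgen hconn m
    exact Submodule.mem_iSup_of_mem j (by first | exact hj.1 | exact hj.2)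

/-- sufficiency in Proposition 2.5: if I is a generator
satisfying the connectedness condition, then H_∞(I) is dense in every C^r
topology on smooth (2πℤ^d)-periodic functions. -/
theorem stmt9 (d : ℕ) (hd : 1 ≤ d) (I : Finset (Fin d → ℤ)) (hI : ∀ k ∈ I, k ≠ 0)
    (hgen : IsGenerator d I) (hconn : ConnectedSet d I) (r : ℕ)
    (f : (Fin d → ℝ) → ℝ) (hf : ContDiff ℝ (⊤ : ℕ∞) f) (hper : Periodic2pi d f)
    (ε : ℝ) (hε : 0 < ε) :
    ∃ g ∈ Hinf d I, ∀ j ≤ r, ∀ x : Fin d → ℝ,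
      ‖iteratedFDeriv ℝ j (f - g) x‖ < ε := by
  have hd' : (1 : ℝ) ≤ d := by exact_mod_cast hd
  have hu : f ∈ smoothPeriodic d := ⟨hf, hper⟩
  obtain ⟨p, hp, hbd⟩ := exists_trigPoly_partialsBounded r hu
    (show 0 < ε / (2 * (d : ℝ) ^ r) by positivity)
  refine ⟨p, ?_, fun j hj x => ?_⟩
  · rw [← coe_iSup_HSubmodule]
    exact trigPoly_le_iSup_HSubmodule hgen hconn hp
  · have hsub := (smoothPeriodic d).sub_mem hu (trigPoly_le_smoothPeriodic d hp)
    calc ‖iteratedFDeriv ℝ j (f - p) x‖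
        ≤ (d : ℝ) ^ j * (ε / (2 * (d : ℝ) ^ r)) := hbd.norm_iteratedFDeriv_le hsub hj x
      _ ≤ (d : ℝ) ^ r * (ε / (2 * (d : ℝ) ^ r)) := by gcongr
      _ = ε / 2 := by field_simp
      _ < ε := half_lt_self hε
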